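/- arXiv:1002.1769 — 4 statements merged into one kernel-verified Lean document; each statement's English description precedes it below -/
import Mathlib

section
/- Let u : ℝ × ℝ → ℝ be a smooth function of (x,t) that is nowhere zero, and for each fixed t let L and B be the differential operators in x acting on smooth functions f : ℝ × ℝ → ℝ by (L f)(x,t) = u² f_xx and (B f)(x,t) = 4u³ f_xxx + 6u² u_x f_xx. Then the Lax equation [∂_t + B, L] = 0 holds, i.e. (∂_t + B)(L f) = L((∂_t + B) f) for every smooth f : ℝ × ℝ → ℝ, if and only if u satisfies the Harry Dym equation u_t = −u³ u_xxx at every point. -/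
/-- Partial derivative with respect to the first variable (x). -/
noncomputable def pdx (f : ℝ × ℝ → ℝ) : ℝ × ℝ → ℝ := fun p => deriv (fun x => f (x, p.2)) p.1

/-- Partial derivative with respect to the second variable (t). -/
noncomputable def pdt (f : ℝ × ℝ → ℝ) : ℝ × ℝ → ℝ := fun p => deriv (fun t => f (p.1, t)) p.2

/-- The Harry Dym Lax operator `L f = u² f_xx`. -/
noncomputable def Lop (u f : ℝ × ℝ → ℝ) : ℝ × ℝ → ℝ :=
  fun p => (u p) ^ 2 * pdx (pdx f) p

/-- The operator `B f = 4u³ f_xxx + 6u² u_x f_xx`. -/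
noncomputable def Bop (u f : ℝ × ℝ → ℝ) : ℝ × ℝ → ℝ :=
  fun p => 4 * (u p) ^ 3 * pdx (pdx (pdx f)) p + 6 * (u p) ^ 2 * pdx u p * pdx (pdx f) p

section PartialDerivatives

variable {f g : ℝ × ℝ → ℝ}

theorem pdx_eq_fderiv (hf : ContDiff ℝ (⊤ : ℕ∞) f) :
    pdx f = fun p => fderiv ℝ f p (1, 0) := by
  funext p
  have h : HasDerivAt (fun x : ℝ => (x, p.2)) ((1 : ℝ), (0 : ℝ)) p.1 :=
    (hasDerivAt_id p.1).prodMk (hasDerivAt_const p.1 p.2)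
  have hd : HasFDerivAt f (fderiv ℝ f p) (p.1, p.2) :=
    (hf.differentiable (by simp) p).hasFDerivAt
  exact (hd.comp_hasDerivAt p.1 h).deriv

theorem pdt_eq_fderiv (hf : ContDiff ℝ (⊤ : ℕ∞) f) :
    pdt f = fun p => fderiv ℝ f p (0, 1) := by
  funext p
  have h : HasDerivAt (fun t : ℝ => (p.1, t)) ((0 : ℝ), (1 : ℝ)) p.2 :=
    (hasDerivAt_const p.2 p.1).prodMk (hasDerivAt_id p.2)
  have hd : HasFDerivAt f (fderiv ℝ f p) (p.1, p.2) :=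
    (hf.differentiable (by simp) p).hasFDerivAt
  exact (hd.comp_hasDerivAt p.2 h).deriv

theorem contDiff_pdx (hf : ContDiff ℝ (⊤ : ℕ∞) f) : ContDiff ℝ (⊤ : ℕ∞) (pdx f) := by
  rw [pdx_eq_fderiv hf]
  exact (hf.fderiv_right (by simp)).clm_apply contDiff_const

theorem contDiff_pdt (hf : ContDiff ℝ (⊤ : ℕ∞) f) : ContDiff ℝ (⊤ : ℕ∞) (pdt f) := by
  rw [pdt_eq_fderiv hf]
  exact (hf.fderiv_right (by simp)).clm_apply contDiff_const

theorem pdt_pdx_comm (hf : ContDiff ℝ (⊤ : ℕ∞) f) : pdt (pdx f) = pdx (pdt f) := by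
  have hd : ContDiff ℝ (⊤ : ℕ∞) (fderiv ℝ f) := hf.fderiv_right (by simp)
  funext p
  have hdp : DifferentiableAt ℝ (fderiv ℝ f) p := hd.differentiable (by simp) p
  rw [pdt_eq_fderiv (contDiff_pdx hf), pdx_eq_fderiv (contDiff_pdt hf),
    pdx_eq_fderiv hf, pdt_eq_fderiv hf]
  have hs : IsSymmSndFDerivAt ℝ f p :=
    hf.contDiffAt.isSymmSndFDerivAt
      (by simpa using WithTop.coe_le_coe.2 (le_top : (2 : ℕ∞) ≤ ⊤))
  simpa [fderiv_clm_apply hdp (differentiableAt_const _)] using hs (0, 1) (1, 0)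

theorem pdx_add (hf : ContDiff ℝ (⊤ : ℕ∞) f) (hg : ContDiff ℝ (⊤ : ℕ∞) g) :
    pdx (fun p => f p + g p) = fun p => pdx f p + pdx g p := by
  have hf' := hf.differentiable (by simp)
  have hg' := hg.differentiable (by simp)
  funext p
  exact deriv_fun_add (by fun_prop) (by fun_prop)

theorem pdx_mul (hf : ContDiff ℝ (⊤ : ℕ∞) f) (hg : ContDiff ℝ (⊤ : ℕ∞) g) :
    pdx (fun p => f p * g p) = fun p => pdx f p * g p + f p * pdx g p := by
  have hf' := hf.differentiable (by simp)
  have hg' := hg.differentiable (by simp)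
  funext p
  exact deriv_fun_mul (c := fun x => f (x, p.2)) (d := fun x => g (x, p.2))
    (by fun_prop) (by fun_prop)

theorem pdt_mul (hf : ContDiff ℝ (⊤ : ℕ∞) f) (hg : ContDiff ℝ (⊤ : ℕ∞) g) :
    pdt (fun p => f p * g p) = fun p => pdt f p * g p + f p * pdt g p := by
  have hf' := hf.differentiable (by simp)
  have hg' := hg.differentiable (by simp)
  funext p
  exact deriv_fun_mul (c := fun t => f (p.1, t)) (d := fun t => g (p.1, t))
    (by fun_prop) (by fun_prop)

theorem pdx_const (c : ℝ) : pdx (fun _ => c) = fun _ => 0 := by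
  funext p
  simp [pdx]

end PartialDerivatives

/-- The operator `[∂_t + B, L]` is multiplication of `f_xx` by `2u (u_t + u³ u_xxx)`. -/
theorem lax_commutator_eq {u f : ℝ × ℝ → ℝ} (hu : ContDiff ℝ (⊤ : ℕ∞) u)
    (hf : ContDiff ℝ (⊤ : ℕ∞) f) (p : ℝ × ℝ) :
    pdt (Lop u f) p + Bop u (Lop u f) p - Lop u (fun q => pdt f q + Bop u f q) p
      = 2 * u p * (pdt u p + u p ^ 3 * pdx (pdx (pdx u)) p) * pdx (pdx f) p := by
  have hcomm : pdt (pdx (pdx f)) = pdx (pdx (pdt f)) := by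
    rw [pdt_pdx_comm (contDiff_pdx hf), pdt_pdx_comm hf]
  have hL : Lop u f = fun q => u q * u q * pdx (pdx f) q := by
    funext q
    simp only [Lop, sq]
  have hu1 := contDiff_pdx hu
  have hu2 := contDiff_pdx hu1
  have hf2 := contDiff_pdx (contDiff_pdx hf)
  have hf3 := contDiff_pdx hf2
  have hf4 := contDiff_pdx hf3
  have hft := contDiff_pdt hf
  have hft1 := contDiff_pdx hft
  rw [hL]
  simp (disch := fun_prop) only [Bop, Lop, pow_succ, pow_zero, one_mul, pdx_add, pdx_mul,
    pdt_mul, pdx_const, hcomm]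
  ring

/-- The Lax equation `[∂_t + B, L] = 0` holds iff `u` satisfies the Harry Dym equation
`u_t = −u³ u_xxx`. -/
theorem harry_dym_lax_iff (u : ℝ × ℝ → ℝ) (hu : ContDiff ℝ (⊤ : ℕ∞) u) (hne : ∀ p, u p ≠ 0) :
    (∀ f : ℝ × ℝ → ℝ, ContDiff ℝ (⊤ : ℕ∞) f → ∀ p : ℝ × ℝ,
        pdt (Lop u f) p + Bop u (Lop u f) p
          = Lop u (fun q => pdt f q + Bop u f q) p)
    ↔ (∀ p : ℝ × ℝ, pdt u p = -(u p) ^ 3 * pdx (pdx (pdx u)) p) := by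
  constructor
  · intro h p
    have hx : ContDiff ℝ (⊤ : ℕ∞) (fun q : ℝ × ℝ => q.1 ^ 2) := by fun_prop
    have hxx : pdx (pdx (fun q : ℝ × ℝ => q.1 ^ 2)) p = 2 := by
      simp [pdx]
    have hk := lax_commutator_eq hu hx p
    rw [h _ hx p, sub_self, hxx] at hk
    have hz : pdt u p + u p ^ 3 * pdx (pdx (pdx u)) p = 0 := by
      simpa [hne p] using hk.symm
    linarith
  · intro h f hf p
    have hk := lax_commutator_eq hu hf p
    rw [h p] at hk
    linarith
end

section
/- Let v : ℝ × ℝ → ℝ be a smooth function of (y,τ), and for each fixed τ let L̂ and B̂ be the differential operators in y acting on smooth functions f : ℝ × ℝ → ℝ by (L̂ f)(y,τ) = f_yy + v f_y and (B̂ f)(y,τ) = 4 f_yyy + 6 v f_yy + (3 v_y + (3/2) v²) f_y. Then the Lax equation [∂_τ + B̂, L̂] = 0 holds, i.e. (∂_τ + B̂)(L̂ f) = L̂((∂_τ + B̂) f) for every smooth f : ℝ × ℝ → ℝ, if and only if v satisfies the modified Korteweg–de Vries equation v_τ = −v_yyy + (3/2) v² v_y at every point. -/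
/-- Partial derivative with respect to the first variable (y). -/
noncomputable def pdy (f : ℝ × ℝ → ℝ) : ℝ × ℝ → ℝ := fun p => deriv (fun y => f (y, p.2)) p.1

/-- Partial derivative with respect to the second variable (τ). -/
noncomputable def pdtau (f : ℝ × ℝ → ℝ) : ℝ × ℝ → ℝ := fun p => deriv (fun t => f (p.1, t)) p.2

/-- The MKdV Lax operator `L̂ f = f_yy + v f_y`. -/
noncomputable def Lhat (v f : ℝ × ℝ → ℝ) : ℝ × ℝ → ℝ :=
  fun p => pdy (pdy f) p + v p * pdy f p

/-- The operator `B̂ f = 4 f_yyy + 6 v f_yy + (3 v_y + (3/2) v²) f_y`. -/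
noncomputable def Bhat (v f : ℝ × ℝ → ℝ) : ℝ × ℝ → ℝ :=
  fun p => 4 * pdy (pdy (pdy f)) p + 6 * v p * pdy (pdy f) p
    + (3 * pdy v p + (3 / 2) * (v p) ^ 2) * pdy f p

open scoped ContDiff

theorem pdy_eq_fderiv {f : ℝ × ℝ → ℝ} (hf : ContDiff ℝ ∞ f) :
    pdy f = fun p => fderiv ℝ f p (1, 0) := by
  funext p
  have h : HasDerivAt (fun y : ℝ => (y, p.2)) ((1 : ℝ), (0 : ℝ)) p.1 :=
    (hasDerivAt_id p.1).prodMk (hasDerivAt_const p.1 p.2)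
  exact ((hf.differentiable (by simp) p).hasFDerivAt.comp_hasDerivAt p.1 h).deriv

theorem pdtau_eq_fderiv {f : ℝ × ℝ → ℝ} (hf : ContDiff ℝ ∞ f) :
    pdtau f = fun p => fderiv ℝ f p (0, 1) := by
  funext p
  have h : HasDerivAt (fun t : ℝ => (p.1, t)) ((0 : ℝ), (1 : ℝ)) p.2 :=
    (hasDerivAt_const p.2 p.1).prodMk (hasDerivAt_id p.2)
  exact ((hf.differentiable (by simp) p).hasFDerivAt.comp_hasDerivAt p.2 h).deriv

@[fun_prop]
theorem ContDiff.pdy {f : ℝ × ℝ → ℝ} (hf : ContDiff ℝ ∞ f) : ContDiff ℝ ∞ (pdy f) := by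
  rw [pdy_eq_fderiv hf]
  exact (hf.fderiv_right (by simp)).clm_apply contDiff_const

@[fun_prop]
theorem ContDiff.pdtau {f : ℝ × ℝ → ℝ} (hf : ContDiff ℝ ∞ f) : ContDiff ℝ ∞ (pdtau f) := by
  rw [pdtau_eq_fderiv hf]
  exact (hf.fderiv_right (by simp)).clm_apply contDiff_const

theorem pdtau_pdy {f : ℝ × ℝ → ℝ} (hf : ContDiff ℝ ∞ f) : pdtau (pdy f) = pdy (pdtau f) := by
  rw [pdtau_eq_fderiv hf.pdy, pdy_eq_fderiv hf.pdtau, pdy_eq_fderiv hf, pdtau_eq_fderiv hf]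
  funext p
  have h : DifferentiableAt ℝ (fderiv ℝ f) p :=
    (hf.fderiv_right (m := ∞) (by simp)).differentiable (by simp) p
  have hs : IsSymmSndFDerivAt ℝ f p :=
    hf.contDiffAt.isSymmSndFDerivAt
      (by simpa using WithTop.coe_le_coe.mpr (le_top : (2 : ℕ∞) ≤ ⊤))
  rw [fderiv_clm_apply h (differentiableAt_const _), fderiv_clm_apply h (differentiableAt_const _)]
  simpa using hs.eq (0, 1) (1, 0)

theorem pdy_const (c : ℝ) : pdy (fun _ => c) = fun _ => 0 := by
  funext p
  simp [pdy]

theorem pdy_add {f g : ℝ × ℝ → ℝ} (hf : ContDiff ℝ ∞ f) (hg : ContDiff ℝ ∞ g) :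
    pdy (fun p => f p + g p) = fun p => pdy f p + pdy g p := by
  rw [pdy_eq_fderiv (hf.add hg), pdy_eq_fderiv hf, pdy_eq_fderiv hg]
  funext p
  rw [fderiv_fun_add (hf.differentiable (by simp) p) (hg.differentiable (by simp) p)]
  rfl

theorem pdy_mul {f g : ℝ × ℝ → ℝ} (hf : ContDiff ℝ ∞ f) (hg : ContDiff ℝ ∞ g) :
    pdy (fun p => f p * g p) = fun p => pdy f p * g p + f p * pdy g p := by
  rw [pdy_eq_fderiv (hf.mul hg), pdy_eq_fderiv hf, pdy_eq_fderiv hg]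
  funext p
  rw [fderiv_fun_mul (hf.differentiable (by simp) p) (hg.differentiable (by simp) p)]
  simp
  ring

theorem pdtau_add {f g : ℝ × ℝ → ℝ} (hf : ContDiff ℝ ∞ f) (hg : ContDiff ℝ ∞ g) :
    pdtau (fun p => f p + g p) = fun p => pdtau f p + pdtau g p := by
  rw [pdtau_eq_fderiv (hf.add hg), pdtau_eq_fderiv hf, pdtau_eq_fderiv hg]
  funext p
  rw [fderiv_fun_add (hf.differentiable (by simp) p) (hg.differentiable (by simp) p)]
  rfl

theorem pdtau_mul {f g : ℝ × ℝ → ℝ} (hf : ContDiff ℝ ∞ f) (hg : ContDiff ℝ ∞ g) :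
    pdtau (fun p => f p * g p) = fun p => pdtau f p * g p + f p * pdtau g p := by
  rw [pdtau_eq_fderiv (hf.mul hg), pdtau_eq_fderiv hf, pdtau_eq_fderiv hg]
  funext p
  rw [fderiv_fun_mul (hf.differentiable (by simp) p) (hg.differentiable (by simp) p)]
  simp
  ring

/-- The commutator `[∂_τ + B̂, L̂]` is the first-order operator
`(v_τ + v_yyy - (3/2) v² v_y) ∂_y`. -/
theorem lax_commutator_apply {v f : ℝ × ℝ → ℝ} (hv : ContDiff ℝ ∞ v) (hf : ContDiff ℝ ∞ f)
    (p : ℝ × ℝ) :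
    pdtau (Lhat v f) p + Bhat v (Lhat v f) p - Lhat v (fun q => pdtau f q + Bhat v f q) p
      = (pdtau v p + pdy (pdy (pdy v)) p - (3 / 2) * (v p) ^ 2 * pdy v p) * pdy f p := by
  unfold Bhat Lhat
  simp (disch := fun_prop) only [pow_two, pdy_add, pdy_mul, pdtau_add, pdtau_mul, pdy_const,
    pdtau_pdy]
  ring

/-- The Lax equation `[∂_τ + B̂, L̂] = 0` holds iff `v` satisfies the MKdV equation
`v_τ = −v_yyy + (3/2) v² v_y`. -/
theorem mkdv_lax_iff (v : ℝ × ℝ → ℝ) (hv : ContDiff ℝ (⊤ : ℕ∞) v) :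
    (∀ f : ℝ × ℝ → ℝ, ContDiff ℝ (⊤ : ℕ∞) f → ∀ p : ℝ × ℝ,
        pdtau (Lhat v f) p + Bhat v (Lhat v f) p
          = Lhat v (fun q => pdtau f q + Bhat v f q) p)
    ↔ (∀ p : ℝ × ℝ, pdtau v p = -pdy (pdy (pdy v)) p + (3 / 2) * (v p) ^ 2 * pdy v p) := by
  constructor
  · intro h p
    have hf : ContDiff ℝ ∞ (fun q : ℝ × ℝ => q.1) := contDiff_fst
    have hy : pdy (fun q : ℝ × ℝ => q.1) p = 1 := by simp [pdy]
    have key := lax_commutator_apply hv hf p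
    rw [sub_eq_zero.mpr (h _ hf p), hy] at key
    linarith
  · intro h f hf p
    rw [← sub_eq_zero, lax_commutator_apply hv hf p, h p]
    ring
end

section
/- Let s : ℝ → ℝ be smooth and everywhere positive and set v = −s'/s. Define, for smooth f : ℝ → ℝ, the operators (B̂ f)(y) = 4 f''' + 6 v f'' + (3 v' + (3/2) v²) f' and (B f)(y) = 4 s³ · (s⁻¹ d/dy)³ f + 6 s² (s⁻¹ s') · (s⁻¹ d/dy)² f (the Harry Dym operator B = 4u³∂_x³ + 6u²u_x∂_x² with u = s and ∂_x = s⁻¹∂_y). Then for every smooth f and every y ∈ ℝ, (B̂ f)(y) − (B f)(y) = (s''/s − (3/2)(s'/s)²)·f'(y). -/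
/-- The operator `s⁻¹ d/dy`. -/
noncomputable def Dop (s f : ℝ → ℝ) : ℝ → ℝ := fun y => (s y)⁻¹ * deriv f y

theorem ContDiff.differentiable_deriv_of_infty {f : ℝ → ℝ} (hf : ContDiff ℝ (⊤ : ℕ∞) f) :
    Differentiable ℝ (deriv f) :=
  (contDiff_infty_iff_deriv.1 hf).2.differentiable (by simp)

theorem Dop_Dop_eq {s f : ℝ → ℝ} (hs : Differentiable ℝ s) (h0 : ∀ y, s y ≠ 0)
    (hf : Differentiable ℝ (deriv f)) :
    Dop s (Dop s f) =
      fun y => (deriv (deriv f) y * s y - deriv f y * deriv s y) / s y ^ 3 := by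
  funext y
  have h : HasDerivAt (Dop s f)
      (-deriv s y / s y ^ 2 * deriv f y + (s y)⁻¹ * deriv (deriv f) y) y :=
    ((hs y).hasDerivAt.inv (h0 y)).mul (hf y).hasDerivAt
  have hy := h0 y
  change (s y)⁻¹ * deriv (Dop s f) y = _
  rw [h.deriv]
  field_simp
  ring

/-- With `v = −s'/s`, the difference between the transformed operator
`B̂ f = 4 f''' + 6 v f'' + (3 v' + (3/2) v²) f'` and the Harry Dym operator
`B f = 4 s³ (s⁻¹ d/dy)³ f + 6 s² (s⁻¹ s') (s⁻¹ d/dy)² f` is multiplication of `f'` by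
`s''/s − (3/2)(s'/s)²`. -/
theorem liouville_B_operator_difference
    (s : ℝ → ℝ) (hs : ContDiff ℝ (⊤ : ℕ∞) s) (hpos : ∀ y, 0 < s y)
    (v : ℝ → ℝ) (hv : v = fun y => -(deriv s y) / s y) :
    ∀ f : ℝ → ℝ, ContDiff ℝ (⊤ : ℕ∞) f → ∀ y : ℝ,
      (4 * deriv (deriv (deriv f)) y + 6 * v y * deriv (deriv f) y
          + (3 * deriv v y + (3 / 2) * (v y) ^ 2) * deriv f y)
        - (4 * (s y) ^ 3 * Dop s (Dop s (Dop s f)) y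
          + 6 * (s y) ^ 2 * ((s y)⁻¹ * deriv s y) * Dop s (Dop s f) y)
      = (deriv (deriv s) y / s y - (3 / 2) * (deriv s y / s y) ^ 2) * deriv f y := by
  intro f hf y
  have hs' := (hs.differentiable (by simp) y).hasDerivAt
  have hs'' := (hs.differentiable_deriv_of_infty y).hasDerivAt
  have hf₂ := (hf.differentiable_deriv_of_infty y).hasDerivAt
  have hf₃ :=
    ((contDiff_infty_iff_deriv.1 hf).2.differentiable_deriv_of_infty y).hasDerivAt
  have h0 : ∀ y, s y ≠ 0 := fun y => (hpos y).ne'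
  have hy := h0 y
  have hD2 := Dop_Dop_eq (hs.differentiable (by simp)) h0 hf.differentiable_deriv_of_infty
  have hD3 : Dop s (Dop s (Dop s f)) y = (s y)⁻¹ * deriv (Dop s (Dop s f)) y := rfl
  have hv' : HasDerivAt v (((-deriv (deriv s) y) * s y - (-deriv s y) * deriv s y) / s y ^ 2) y :=
    hv.symm ▸ hs''.neg.fun_div hs' hy
  have hd2 := (((hf₃.fun_mul hs').fun_sub (hf₂.fun_mul hs'')).fun_div (hs'.fun_pow 3)
    (pow_ne_zero 3 hy)).deriv
  rw [hD3, hD2, hv'.deriv, hd2, hv]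
  field_simp
  ring
end

section
/- Let u : ℝ × ℝ → ℝ be smooth, everywhere positive, and satisfy the Harry Dym equation u_t = −u³ u_xxx at every point. Let y : ℝ × ℝ → ℝ be smooth with ∂y/∂x = u⁻¹ and ∂y/∂t = u·u_xx − (1/2)·u_x² at every point, and let s : ℝ × ℝ → ℝ be a smooth, everywhere positive function of (Y,τ) such that s(y(x,t), t) = u(x,t) for all (x,t). Then at every point of the form (Y,τ) = (y(x,t), t), s satisfies the potential Schwarzian KdV equation s_τ = −∂_Y( s_YY − (3/2)·s_Y²/s ). -/
/-- Partial derivative with respect to the first variable. -/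
noncomputable def pd1 (f : ℝ × ℝ → ℝ) : ℝ × ℝ → ℝ := fun p => deriv (fun x => f (x, p.2)) p.1

/-- Partial derivative with respect to the second variable. -/
noncomputable def pd2 (f : ℝ × ℝ → ℝ) : ℝ × ℝ → ℝ := fun p => deriv (fun t => f (p.1, t)) p.2

/-- A differentiable function has partial derivative `pd1` in the first variable. -/
lemma hasDerivAt_pd1 {f : ℝ × ℝ → ℝ} (hf : Differentiable ℝ f) (a b : ℝ) :
    HasDerivAt (fun x => f (x, b)) (pd1 f (a, b)) a := by
  have h : Differentiable ℝ fun x => f (x, b) := by fun_prop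
  exact (h a).hasDerivAt

/-- A differentiable function has partial derivative `pd2` in the second variable. -/
lemma hasDerivAt_pd2 {f : ℝ × ℝ → ℝ} (hf : Differentiable ℝ f) (a b : ℝ) :
    HasDerivAt (fun t => f (a, t)) (pd2 f (a, b)) b := by
  have h : Differentiable ℝ fun t => f (a, t) := by fun_prop
  exact (h b).hasDerivAt

lemma pd1_eq_fderiv {f : ℝ × ℝ → ℝ} (hf : Differentiable ℝ f) (p : ℝ × ℝ) :
    pd1 f p = fderiv ℝ f p (1, 0) := by
  have h : HasDerivAt (fun x : ℝ => (x, p.2)) ((1 : ℝ), (0 : ℝ)) p.1 :=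
    (hasDerivAt_id p.1).prodMk (hasDerivAt_const p.1 p.2)
  exact ((hf p).hasFDerivAt.comp_hasDerivAt p.1 h).deriv

lemma pd2_eq_fderiv {f : ℝ × ℝ → ℝ} (hf : Differentiable ℝ f) (p : ℝ × ℝ) :
    pd2 f p = fderiv ℝ f p (0, 1) := by
  have h : HasDerivAt (fun t : ℝ => (p.1, t)) ((0 : ℝ), (1 : ℝ)) p.2 :=
    (hasDerivAt_const p.2 p.1).prodMk (hasDerivAt_id p.2)
  exact ((hf p).hasFDerivAt.comp_hasDerivAt p.2 h).deriv

lemma contDiff_pd1 {f : ℝ × ℝ → ℝ} (hf : ContDiff ℝ (⊤ : ℕ∞) f) :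
    ContDiff ℝ (⊤ : ℕ∞) (pd1 f) := by
  rw [funext (pd1_eq_fderiv (hf.differentiable (by simp)))]
  exact (hf.fderiv_right (by simp)).clm_apply contDiff_const

/-- Chain rule along the curve `t ↦ (g t, t)`. -/
lemma hasDerivAt_comp_graph {f : ℝ × ℝ → ℝ} (hf : Differentiable ℝ f) {g : ℝ → ℝ} {g' b : ℝ}
    (hg : HasDerivAt g g' b) :
    HasDerivAt (fun t => f (g t, t)) (pd1 f (g b, b) * g' + pd2 f (g b, b)) b := by
  have h : HasDerivAt (fun t : ℝ => (g t, t)) (g', (1 : ℝ)) b := hg.prodMk (hasDerivAt_id b)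
  have hv : ((g', 1) : ℝ × ℝ) = g' • ((1, 0) : ℝ × ℝ) + (0, 1) := by simp
  have hd : fderiv ℝ f (g b, b) (g', 1) = pd1 f (g b, b) * g' + pd2 f (g b, b) := by
    rw [hv, map_add, map_smul, ← pd1_eq_fderiv hf, ← pd2_eq_fderiv hf, smul_eq_mul, mul_comm]
  rw [← hd]
  exact HasFDerivAt.comp_hasDerivAt (f := fun t : ℝ => (g t, t)) b (hf (g b, b)).hasFDerivAt h

/-- Under the reciprocal transformation `y_x = u⁻¹`, `y_t = uu_xx − (1/2)u_x²`, `τ = t`,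
a positive solution `u` of the Harry Dym equation `u_t = −u³u_xxx` is mapped to a solution
`s(y,τ) = u(x,t)` of the potential Schwarzian KdV equation
`s_τ = −∂_y(s_yy − (3/2)s_y²/s)` at every point `(y(x,t), t)`. -/
theorem harry_dym_reciprocal_to_potential_schwarzianKdV
    (u y s : ℝ × ℝ → ℝ)
    (hu : ContDiff ℝ (⊤ : ℕ∞) u) (hupos : ∀ p, 0 < u p)
    (hHD : ∀ p : ℝ × ℝ, pd2 u p = -(u p) ^ 3 * pd1 (pd1 (pd1 u)) p)
    (hy : ContDiff ℝ (⊤ : ℕ∞) y)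
    (hyx : ∀ p : ℝ × ℝ, pd1 y p = (u p)⁻¹)
    (hyt : ∀ p : ℝ × ℝ, pd2 y p = u p * pd1 (pd1 u) p - (1 / 2) * (pd1 u p) ^ 2)
    (hs : ContDiff ℝ (⊤ : ℕ∞) s) (hspos : ∀ q, 0 < s q)
    (hcomp : ∀ p : ℝ × ℝ, s (y p, p.2) = u p) :
    ∀ p : ℝ × ℝ,
      pd2 s (y p, p.2)
        = -pd1 (fun q => pd1 (pd1 s) q - (3 / 2) * (pd1 s q) ^ 2 / s q) (y p, p.2) := by
  have diff : ∀ {f : ℝ × ℝ → ℝ}, ContDiff ℝ (⊤ : ℕ∞) f → Differentiable ℝ f :=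
    fun hf => hf.differentiable (by simp)
  have hs₁ := contDiff_pd1 hs
  have hs₂ := contDiff_pd1 hs₁
  have hne : ∀ q, s q ≠ 0 := fun q => (hspos q).ne'
  have chain : ∀ {f : ℝ × ℝ → ℝ}, ContDiff ℝ (⊤ : ℕ∞) f → ∀ a b : ℝ,
      HasDerivAt (fun x => f (y (x, b), b)) (pd1 f (y (a, b), b) * (s (y (a, b), b))⁻¹) a := by
    intro f hf a b
    have h := hasDerivAt_pd1 (diff hy) a b
    rw [hyx, ← hcomp] at h
    exact (hasDerivAt_pd1 (diff hf) (y (a, b)) b).comp a h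
  have hu₁ : ∀ p : ℝ × ℝ, pd1 u p = pd1 s (y p, p.2) / s (y p, p.2) := by
    rintro ⟨a, b⟩
    rw [← funext hcomp]
    exact (chain hs a b).deriv
  have hu₂ : ∀ p : ℝ × ℝ, pd1 (pd1 u) p =
      pd1 (pd1 s) (y p, p.2) / s (y p, p.2) ^ 2 - pd1 s (y p, p.2) ^ 2 / s (y p, p.2) ^ 3 := by
    rintro ⟨a, b⟩
    rw [funext hu₁]
    refine ((chain hs₁ a b).div (chain hs a b) (hne _)).deriv.trans ?_
    have := hne (y (a, b), b)
    field_simp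
  have hu₃ : ∀ p : ℝ × ℝ, pd1 (pd1 (pd1 u)) p =
      pd1 (pd1 (pd1 s)) (y p, p.2) / s (y p, p.2) ^ 3
        - 4 * pd1 s (y p, p.2) * pd1 (pd1 s) (y p, p.2) / s (y p, p.2) ^ 4
        + 3 * pd1 s (y p, p.2) ^ 3 / s (y p, p.2) ^ 5 := by
    rintro ⟨a, b⟩
    rw [funext hu₂]
    refine (((chain hs₂ a b).div ((chain hs a b).pow 2) (pow_ne_zero 2 (hne _))).sub
      (((chain hs₁ a b).pow 2).div ((chain hs a b).pow 3) (pow_ne_zero 3 (hne _)))).deriv.trans ?_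
    have := hne (y (a, b), b)
    simp only [Pi.pow_apply]
    field_simp
    ring
  rintro ⟨a, b⟩
  have ht : pd2 u (a, b) =
      pd1 s (y (a, b), b) * pd2 y (a, b) + pd2 s (y (a, b), b) := by
    conv_lhs => rw [← funext hcomp]
    exact (hasDerivAt_comp_graph (diff hs) (hasDerivAt_pd2 (diff hy) a b)).deriv
  have hR : pd1 (fun q => pd1 (pd1 s) q - (3 / 2) * (pd1 s q) ^ 2 / s q) (y (a, b), b) = _ :=
    ((hasDerivAt_pd1 (diff hs₂) (y (a, b)) b).sub
      ((((hasDerivAt_pd1 (diff hs₁) (y (a, b)) b).pow 2).const_mul (3 / 2)).div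
        (hasDerivAt_pd1 (diff hs) (y (a, b)) b) (hne _))).deriv
  rw [hHD, hyt, hu₃, hu₂, hu₁, ← hcomp] at ht
  rw [eq_sub_of_add_eq' ht.symm, hR]
  have := hne (y (a, b), b)
  simp only [Pi.pow_apply]
  field_simp
  ring
end
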